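/- Let Φ : ℝⁿ → ℝᵐ be a linear map, y ∈ ℝᵐ, and let S = {x ∈ ℝⁿ : Φx = y}. Let k ∈ ℕ with k ≥ 1, and suppose x* ∈ S is the unique sparsest solution: ‖x*‖₀ = k and every z ∈ S with z ≠ x* satisfies ‖z‖₀ > k. Let ε > 0 be such that for every support set A ⊆ {1, …, n} whose coordinate subspace V_A is disjoint from S, one has ‖x − u‖₂ ≥ ε for all x ∈ S and u ∈ V_A. If 0 < λ < ε²/k, then the minimum of f(x, A) = Σ_{i∉A} xᵢ² + λ|A| over all x ∈ S and all support sets A ⊆ {1, …, n} equals λk, and it is attained exactly at x = x* and A = supp(x*) (the set of nonzero coordinates of x*); i.e., the optimum of the INPMAT objective recovers the sparsest solution. -/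

import Mathlib

open Finset

/-- If `x` is at distance at least `ε` from the coordinate subspace supported on `A`, then the squares
of the coordinates of `x` outside `A` sum to at least `ε ^ 2`. -/
theorem sq_le_sum_compl_of_le_norm_sub {n : ℕ} (x : EuclideanSpace ℝ (Fin n)) (A : Finset (Fin n))
    {ε : ℝ} (hε : 0 ≤ ε)
    (h : ∀ u : EuclideanSpace ℝ (Fin n), (∀ i ∉ A, u i = 0) → ε ≤ ‖x - u‖) :
    ε ^ 2 ≤ ∑ i ∈ Aᶜ, x i ^ 2 := by
  let u : EuclideanSpace ℝ (Fin n) := WithLp.toLp 2 fun i => if i ∈ A then x i else 0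
  have hu : ‖x - u‖ ^ 2 = ∑ i ∈ Aᶜ, x i ^ 2 := by
    rw [EuclideanSpace.real_norm_sq_eq, ← Finset.sum_add_sum_compl A,
      Finset.sum_eq_zero fun i hi => by simp [u, hi], zero_add]
    refine Finset.sum_congr rfl fun i hi => ?_
    simp [u, Finset.mem_compl.mp hi]
  rw [← hu]
  exact pow_le_pow_left₀ hε (h u fun i hi => by simp [u, hi]) 2

/-- If `x*` is the unique sparsest solution of `Φ x = y` (with sparsity `k`), every
support subspace `V_A` disjoint from the solution set `S` is at distance at least
`ε` from `S`, and `0 < λ < ε²/k`, then the minimum of the INPMAT objective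
`f(x, A) = Σ_{i∉A} xᵢ² + λ|A|` over `x ∈ S` and supports `A` equals `λ k`, and it
is attained exactly at `x = x*` and `A = supp(x*)`. -/
theorem inpmat_recovers_sparsest_solution
    (n m : ℕ) (Φ : EuclideanSpace ℝ (Fin n) →ₗ[ℝ] EuclideanSpace ℝ (Fin m))
    (y : EuclideanSpace ℝ (Fin m))
    (k : ℕ) (hk : 1 ≤ k)
    (xstar : EuclideanSpace ℝ (Fin n)) (hxstar : Φ xstar = y)
    (hxsparse : (Finset.univ.filter (fun i => xstar i ≠ 0)).card = k)
    (huniq : ∀ z : EuclideanSpace ℝ (Fin n), Φ z = y → z ≠ xstar →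
      k < (Finset.univ.filter (fun i => z i ≠ 0)).card)
    (ε : ℝ) (hε : 0 < ε)
    (hdist : ∀ A : Finset (Fin n),
      (¬ ∃ z : EuclideanSpace ℝ (Fin n), Φ z = y ∧ ∀ i ∉ A, z i = 0) →
      ∀ x : EuclideanSpace ℝ (Fin n), Φ x = y →
        ∀ u : EuclideanSpace ℝ (Fin n), (∀ i ∉ A, u i = 0) → ε ≤ ‖x - u‖)
    (lam : ℝ) (hlam : 0 < lam) (hlam' : lam < ε ^ 2 / k) :
    (∀ x : EuclideanSpace ℝ (Fin n), Φ x = y → ∀ A : Finset (Fin n),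
        lam * k ≤ ∑ i ∈ Aᶜ, x i ^ 2 + lam * A.card) ∧
    (∑ i ∈ (Finset.univ.filter (fun i => xstar i ≠ 0))ᶜ, xstar i ^ 2 +
        lam * (Finset.univ.filter (fun i => xstar i ≠ 0)).card = lam * k) ∧
    (∀ x : EuclideanSpace ℝ (Fin n), Φ x = y → ∀ A : Finset (Fin n),
        (∑ i ∈ Aᶜ, x i ^ 2 + lam * A.card = lam * k) →
        x = xstar ∧ A = Finset.univ.filter (fun i => xstar i ≠ 0)) := by
  have hk' : (0 : ℝ) < k := by exact_mod_cast hk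
  have hlamk : lam * k < ε ^ 2 := (lt_div_iff₀ hk').mp hlam'
  have hsupp : ∀ (z : EuclideanSpace ℝ (Fin n)) (A : Finset (Fin n)), (∀ i ∉ A, z i = 0) →
      Finset.univ.filter (fun i => z i ≠ 0) ⊆ A := fun z A hz i hi => by
    by_contra hiA
    exact (Finset.mem_filter.mp hi).2 (hz i hiA)
  have hcard : ∀ (z : EuclideanSpace ℝ (Fin n)) (A : Finset (Fin n)), Φ z = y →
      (∀ i ∉ A, z i = 0) → k ≤ A.card := fun z A hz hzA => by
    have hle := Finset.card_le_card (hsupp z A hzA)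
    by_cases h : z = xstar
    · rwa [h, hxsparse] at hle
    · exact (huniq z hz h).le.trans hle
  have hfar : ∀ (x : EuclideanSpace ℝ (Fin n)) (A : Finset (Fin n)), Φ x = y →
      (¬ ∃ z : EuclideanSpace ℝ (Fin n), Φ z = y ∧ ∀ i ∉ A, z i = 0) →
      lam * k < ∑ i ∈ Aᶜ, x i ^ 2 + lam * A.card := fun x A hx hA => by
    have hle := sq_le_sum_compl_of_le_norm_sub x A hε.le (hdist A hA x hx)
    have hnonneg : 0 ≤ lam * A.card := by positivity
    linarith
  have hsum : ∀ (x : EuclideanSpace ℝ (Fin n)) (A : Finset (Fin n)), 0 ≤ ∑ i ∈ Aᶜ, x i ^ 2 :=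
    fun x A => Finset.sum_nonneg fun i _ => sq_nonneg _
  refine ⟨fun x hx A => ?_, ?_, fun x hx A hf => ?_⟩
  · by_cases hA : ∃ z : EuclideanSpace ℝ (Fin n), Φ z = y ∧ ∀ i ∉ A, z i = 0
    · obtain ⟨z, hz, hzA⟩ := hA
      have hle : (k : ℝ) ≤ A.card := by exact_mod_cast hcard z A hz hzA
      have hmul := mul_le_mul_of_nonneg_left hle hlam.le
      linarith [hsum x A]
    · exact (hfar x A hx hA).le
  · rw [hxsparse, Finset.sum_eq_zero fun i hi => by simpa using hi, zero_add]
  · by_cases hA : ∃ z : EuclideanSpace ℝ (Fin n), Φ z = y ∧ ∀ i ∉ A, z i = 0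
    · obtain ⟨z, hz, hzA⟩ := hA
      have hle : (k : ℝ) ≤ A.card := by exact_mod_cast hcard z A hz hzA
      have hmul := mul_le_mul_of_nonneg_left hle hlam.le
      have hzero : ∑ i ∈ Aᶜ, x i ^ 2 = 0 := by linarith [hsum x A]
      have hAk : A.card ≤ k := by
        have : (A.card : ℝ) ≤ k := le_of_mul_le_mul_left (by linarith) hlam
        exact_mod_cast this
      have hxA : ∀ i ∉ A, x i = 0 := fun i hi => by
        simpa using (Finset.sum_eq_zero_iff_of_nonneg fun i _ => sq_nonneg (x i)).mp hzero i
          (Finset.mem_compl.mpr hi)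
      have hxeq : x = xstar := by
        by_contra h
        exact absurd (Finset.card_le_card (hsupp x A hxA))
          (not_le.mpr (hAk.trans_lt (huniq x hx h)))
      subst hxeq
      exact ⟨rfl, (Finset.eq_of_subset_of_card_le (hsupp x A hxA) (hxsparse ▸ hAk)).symm⟩
    · exact absurd hf (hfar x A hx hA).ne'
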